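/- arXiv:1411.4390 — 7 statements merged into one kernel-verified Lean document; each statement's English description precedes it below -/
import Mathlib

section
/- The fixed points of the geometric triangle transformation are exactly the triangles whose vertices are equidistant from the centroid: if a triangle Δ=(x₀,x₁,x₂) satisfies θ(Δ) = Δ, then ‖x₀−c‖ = ‖x₁−c‖ = ‖x₂−c‖ (i.e. Δ is equilateral). -/
/-- The centroid of a triple of points. -/
noncomputable def centroid {E : Type*} [NormedAddCommGroup E] [NormedSpace ℝ E]
    (x : Fin 3 → E) : E :=
  (3 : ℝ)⁻¹ • (x 0 + x 1 + x 2)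

/-- The ratio `rᵢ = ‖x_{i−1}−c‖/‖xᵢ−c‖` (indices mod 3). -/
noncomputable def tratio {E : Type*} [NormedAddCommGroup E] [NormedSpace ℝ E]
    (x : Fin 3 → E) (i : Fin 3) : ℝ :=
  ‖x (i - 1) - centroid x‖ / ‖x i - centroid x‖

/-- The geometric triangle transformation `θ`:
`xᵢ⁽¹⁾ = (1/3)(2rᵢ(xᵢ−c) − r_{i+1}(x_{i+1}−c) − r_{i−1}(x_{i−1}−c)) + c`. -/
noncomputable def theta {E : Type*} [NormedAddCommGroup E] [NormedSpace ℝ E]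
    (x : Fin 3 → E) : Fin 3 → E := fun i =>
  (3 : ℝ)⁻¹ • ((2 * tratio x i) • (x i - centroid x)
      - tratio x (i + 1) • (x (i + 1) - centroid x)
      - tratio x (i - 1) • (x (i - 1) - centroid x))
    + centroid x

/-- A triple of points is a triangle iff its points are non-collinear. -/
def IsTriangle {E : Type*} [NormedAddCommGroup E] [NormedSpace ℝ E]
    (x : Fin 3 → E) : Prop :=
  ¬ Collinear ℝ (Set.range x)

section

variable {E : Type*} [NormedAddCommGroup E] [NormedSpace ℝ E]

theorem sub_centroid_add_sub_centroid_add_sub_centroid (x : Fin 3 → E) :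
    (x 0 - centroid x) + (x 1 - centroid x) + (x 2 - centroid x) = 0 := by
  simp only [centroid]
  module

/-- A triple whose points all lie on a line through its centroid is not a triangle. -/
theorem IsTriangle.not_forall_sub_centroid_eq_smul {x : Fin 3 → E} (hx : IsTriangle x)
    (v : E) (t : Fin 3 → ℝ) : ¬ ∀ i, x i - centroid x = t i • v := by
  intro h
  refine hx ((collinear_iff_of_mem (p₀ := x 0) (Set.mem_range_self 0)).2 ⟨v, ?_⟩)
  rintro _ ⟨i, rfl⟩
  refine ⟨t i - t 0, ?_⟩
  rw [sub_smul, ← h, ← h, vadd_eq_add]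
  abel

/-- Consecutive vertices of a triangle, seen from the centroid, are linearly independent. -/
theorem IsTriangle.eq_zero_of_smul_sub_centroid_eq {x : Fin 3 → E} (hx : IsTriangle x)
    {i : Fin 3} {a b : ℝ}
    (h : a • (x i - centroid x) = b • (x (i + 1) - centroid x)) : a = 0 := by
  by_contra ha
  have hi : x i - centroid x = (b / a) • (x (i + 1) - centroid x) := by
    rw [div_eq_inv_mul, mul_smul, ← h, inv_smul_smul₀ ha]
  have hs : (x i - centroid x) + (x (i + 1) - centroid x) + (x (i + 2) - centroid x) = 0 := by
    rw [← sub_centroid_add_sub_centroid_add_sub_centroid x]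
    fin_cases i <;> simp <;> abel
  refine hx.not_forall_sub_centroid_eq_smul (x (i + 1) - centroid x)
    (fun j => if j = i then b / a else if j = i + 1 then 1 else -(1 + b / a)) fun j => ?_
  have hj : j = i ∨ j = i + 1 ∨ j = i + 2 := by lia
  rcases hj with rfl | rfl | rfl
  · simpa using hi
  · simp
  · rw [hi] at hs
    simp only [add_eq_left, add_right_inj, Fin.reduceEq, if_false]
    rw [eq_neg_of_add_eq_zero_right hs]
    module

/-- `θ` fixes `xᵢ` iff `(rᵢ - 1)(xᵢ - c)` is the mean of the vectors `rⱼ(xⱼ - c)`. -/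
theorem tratio_sub_one_smul_of_theta_eq {x : Fin 3 → E} {i : Fin 3} (h : theta x i = x i) :
    (tratio x i - 1) • (x i - centroid x) =
      (3 : ℝ)⁻¹ • ∑ j, tratio x j • (x j - centroid x) := by
  have hs : ∑ j, tratio x j • (x j - centroid x) = tratio x i • (x i - centroid x)
      + tratio x (i + 1) • (x (i + 1) - centroid x)
      + tratio x (i - 1) • (x (i - 1) - centroid x) := by
    rw [Fin.sum_univ_three]
    fin_cases i <;> simp [show (-1 : Fin 3) = 2 from rfl] <;> abel
  rw [hs]
  linear_combination (norm := module) eq_sub_of_add_eq h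

theorem IsTriangle.tratio_eq_one_of_theta_fixed {x : Fin 3 → E} (hx : IsTriangle x)
    (hfix : ∀ i, theta x i = x i) (i : Fin 3) : tratio x i = 1 :=
  sub_eq_zero.1 <| hx.eq_zero_of_smul_sub_centroid_eq <|
    (tratio_sub_one_smul_of_theta_eq (hfix i)).trans
      (tratio_sub_one_smul_of_theta_eq (hfix (i + 1))).symm

end

/-- If a triangle is a fixed point of the geometric triangle transformation, then its
vertices are equidistant from the centroid (i.e. it is equilateral). -/
theorem equidistant_of_theta_fixed
    (x : Fin 3 → EuclideanSpace ℝ (Fin 2)) (hx : IsTriangle x)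
    (hfix : ∀ i : Fin 3, theta x i = x i) :
    ‖x 0 - centroid x‖ = ‖x 1 - centroid x‖ ∧
      ‖x 1 - centroid x‖ = ‖x 2 - centroid x‖ :=
  ⟨eq_of_div_eq_one (hx.tratio_eq_one_of_theta_fixed hfix 1),
    eq_of_div_eq_one (hx.tratio_eq_one_of_theta_fixed hfix 2)⟩
end

section
/- (Lemma 2.2) Let Δ=(x₀,x₁,x₂) and Δ'=(y₀,y₁,y₂) be two similar triangles in ℝ², i.e. there exist A ∈ SO(2,ℝ), σ ∈ ℝ² and a real a > 0 such that yᵢ = a(Axᵢ + σ) for i = 0,1,2. Then the images θ(Δ)=(x₀⁽¹⁾,x₁⁽¹⁾,x₂⁽¹⁾) and θ(Δ')=(y₀⁽¹⁾,y₁⁽¹⁾,y₂⁽¹⁾) are similar to each other in the same way: yᵢ⁽¹⁾ = a(Axᵢ⁽¹⁾ + σ) for i = 0,1,2. -/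
/-- The action of a 2×2 real matrix on a point of the Euclidean plane. -/
noncomputable def matApply (A : Matrix (Fin 2) (Fin 2) ℝ)
    (v : EuclideanSpace ℝ (Fin 2)) : EuclideanSpace ℝ (Fin 2) :=
  (EuclideanSpace.equiv (Fin 2) ℝ).symm (A.mulVec (EuclideanSpace.equiv (Fin 2) ℝ v))

/-- The centroid commutes with a similarity `v ↦ a • (L v + σ)`. -/
theorem centroid_similarity {E F : Type*} [NormedAddCommGroup E] [NormedSpace ℝ E]
    [NormedAddCommGroup F] [NormedSpace ℝ F] (L : E →ₗᵢ[ℝ] F) (σ : F) (a : ℝ) (x : Fin 3 → E) :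
    centroid (fun i => a • (L (x i) + σ)) = a • (L (centroid x) + σ) := by
  simp only [centroid, map_smul, map_add]
  module

/-- A similarity acts on the vectors joining the centroid to the vertices by its linear part. -/
theorem sub_centroid_similarity {E F : Type*} [NormedAddCommGroup E] [NormedSpace ℝ E]
    [NormedAddCommGroup F] [NormedSpace ℝ F] (L : E →ₗᵢ[ℝ] F) (σ : F) (a : ℝ) (x : Fin 3 → E)
    (i : Fin 3) :
    a • (L (x i) + σ) - centroid (fun i => a • (L (x i) + σ)) = a • L (x i - centroid x) := by
  rw [centroid_similarity, map_sub]
  module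

/-- The ratios `rᵢ` are invariant under nondegenerate similarities. -/
theorem tratio_similarity {E F : Type*} [NormedAddCommGroup E] [NormedSpace ℝ E]
    [NormedAddCommGroup F] [NormedSpace ℝ F] (L : E →ₗᵢ[ℝ] F) (σ : F) {a : ℝ} (ha : a ≠ 0)
    (x : Fin 3 → E) (i : Fin 3) :
    tratio (fun i => a • (L (x i) + σ)) i = tratio x i := by
  simp only [tratio, sub_centroid_similarity, norm_smul, L.norm_map]
  exact mul_div_mul_left _ _ (norm_ne_zero_iff.mpr ha)

/-- The transformation `θ` commutes with nondegenerate similarities. -/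
theorem theta_similarity {E F : Type*} [NormedAddCommGroup E] [NormedSpace ℝ E]
    [NormedAddCommGroup F] [NormedSpace ℝ F] (L : E →ₗᵢ[ℝ] F) (σ : F) {a : ℝ} (ha : a ≠ 0)
    (x : Fin 3 → E) (i : Fin 3) :
    theta (fun i => a • (L (x i) + σ)) i = a • (L (theta x i) + σ) := by
  simp only [theta, tratio_similarity L σ ha, sub_centroid_similarity]
  rw [centroid_similarity]
  simp only [map_add, map_sub, map_smul]
  module

/-- An orthogonal matrix preserves the Euclidean norm. -/
theorem norm_matApply {A : Matrix (Fin 2) (Fin 2) ℝ} (hA : A ∈ Matrix.orthogonalGroup (Fin 2) ℝ)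
    (v : EuclideanSpace ℝ (Fin 2)) : ‖matApply A v‖ = ‖v‖ := by
  have h : A.transpose * A = 1 := (Matrix.mem_orthogonalGroup_iff' (Fin 2) ℝ).mp hA
  rw [← sq_eq_sq₀ (norm_nonneg _) (norm_nonneg _), ← real_inner_self_eq_norm_sq,
    ← real_inner_self_eq_norm_sq]
  change A.mulVec v.ofLp ⬝ᵥ A.mulVec v.ofLp = v.ofLp ⬝ᵥ v.ofLp
  rw [Matrix.dotProduct_mulVec, Matrix.vecMul_mulVec, h, Matrix.vecMul_one]

/-- The linear isometry of the Euclidean plane given by an orthogonal matrix. -/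
noncomputable def matApplyIsometry (A : Matrix (Fin 2) (Fin 2) ℝ)
    (hA : A ∈ Matrix.orthogonalGroup (Fin 2) ℝ) :
    EuclideanSpace ℝ (Fin 2) →ₗᵢ[ℝ] EuclideanSpace ℝ (Fin 2) where
  toFun := matApply A
  map_add' v w := by simp only [matApply, map_add, Matrix.mulVec_add]
  map_smul' c v := by simp only [matApply, map_smul, Matrix.mulVec_smul, RingHom.id_apply]
  norm_map' := norm_matApply hA

/-- (Lemma 2.2) If two triangles are similar via `yᵢ = a(Axᵢ + σ)` with `A ∈ SO(2,ℝ)`,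
`σ ∈ ℝ²` and `a > 0`, then their images under `θ` are similar in the same way. -/
theorem theta_maps_similar_to_similar
    (x y : Fin 3 → EuclideanSpace ℝ (Fin 2))
    (hx : IsTriangle x) (hy : IsTriangle y)
    (A : Matrix (Fin 2) (Fin 2) ℝ)
    (hA : A ∈ Matrix.specialOrthogonalGroup (Fin 2) ℝ)
    (σ : EuclideanSpace ℝ (Fin 2)) (a : ℝ) (ha : 0 < a)
    (hsim : ∀ i : Fin 3, y i = a • (matApply A (x i) + σ)) :
    ∀ i : Fin 3, theta y i = a • (matApply A (theta x i) + σ) := by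
  obtain rfl : y = fun i => a • (matApply A (x i) + σ) := funext hsim
  exact theta_similarity (matApplyIsometry A (Matrix.mem_specialOrthogonalGroup_iff.mp hA).1)
    σ ha.ne' x
end

section
/- Under one application of the geometric triangle transformation the maximal distance from the vertices to the centroid strictly decreases: if Δ=(x₀,x₁,x₂) is a triangle whose centroid distances ‖x₀−c‖, ‖x₁−c‖, ‖x₂−c‖ are not all equal, then max_{i=0,1,2} ‖xᵢ⁽¹⁾−c‖ < max_{i=0,1,2} ‖xᵢ−c‖, where θ(Δ)=(x₀⁽¹⁾,x₁⁽¹⁾,x₂⁽¹⁾) and c is the common centroid of Δ and θ(Δ). -/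
/-- A non-equilateral triangle with ordered side lengths, in coordinates in which the order and the
triangle inequality become sign conditions. -/
lemma exists_ordered_triangle_param (l m h : ℝ) (hlm : l ≤ m) (hmh : m ≤ h) (hlt : h < l + m)
    (hne : ¬ (l = m ∧ m = h)) :
    ∃ q s t : ℝ, 0 < q ∧ 0 ≤ s ∧ 0 ≤ t ∧ (0 < s ∨ 0 < t) ∧
      l = q + t ∧ m = q + t + s ∧ h = q + 2 * t + s := by
  refine ⟨l + m - h, m - l, h - m, by linarith, by linarith, by linarith, ?_, by ring, by ring,
    by ring⟩
  by_contra! hc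
  exact hne ⟨by linarith, by linarith⟩

/-- A quintic inequality for the side lengths of a non-equilateral triangle. -/
lemma triangle_quintic_lt {a b c M : ℝ} (ha : 0 < a) (hb : 0 < b) (hc : 0 < c)
    (hab : c < a + b) (hbc : a < b + c) (hca : b < c + a) (hne : ¬ (a = b ∧ b = c))
    (haM : a ≤ M) (hbM : b ≤ M) (hcM : c ≤ M) :
    a * b * c * (4 * c ^ 2 + a ^ 2 + b ^ 2) + 2 * a * c ^ 2 * (a ^ 2 + b ^ 2 - c ^ 2)
      + 2 * b ^ 2 * c * (a ^ 2 + c ^ 2 - b ^ 2) - a ^ 2 * b * (b ^ 2 + c ^ 2 - a ^ 2)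
      < 9 * M ^ 2 * (a * b * c) := by
  have hM : ∀ y, 0 < y → y ≤ M → 9 * y ^ 2 * (a * b * c) ≤ 9 * M ^ 2 * (a * b * c) := by
    intro y hy hyM
    gcongr
  rcases le_total a b with h₁ | h₁
  · rcases le_total b c with h₂ | h₂
    · obtain ⟨q, s, t, hq, hs, ht, hst, rfl, rfl, rfl⟩ :=
        exists_ordered_triangle_param a b c (by assumption) (by assumption) (by linarith)
          (by rintro ⟨h₁, h₂⟩; exact hne ⟨by linarith, by linarith⟩)
      refine lt_of_lt_of_le ?_ (hM _ hc hcM)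
      have key : 0 <
        40 * t^5 + 84 * s * t^4 + 56 * s^2 * t^3 + 12 * s^3 * t^2 + 114 * q * t^4 + 210 *
        q * s * t^3 + 130 * q * s^2 * t^2 + 34 * q * s^3 * t + 4 * q * s^4 + 119 * q^2 *
        t^3 + 186 * q^2 * s * t^2 + 93 * q^2 * s^2 * t + 16 * q^2 * s^3 + 54 * q^3 * t^2 +
        69 * q^3 * s * t + 21 * q^3 * s^2 + 9 * q^4 * t + 9 * q^4 * s := by
        rcases hst with hs | ht <;> positivity
      linarith
    · rcases le_total a c with h₃ | h₃
      · obtain ⟨q, s, t, hq, hs, ht, hst, rfl, rfl, rfl⟩ :=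
          exists_ordered_triangle_param a c b (by assumption) (by assumption) (by linarith)
            (by rintro ⟨h₁, h₂⟩; exact hne ⟨by linarith, by linarith⟩)
        refine lt_of_lt_of_le ?_ (hM _ hb hbM)
        have key : 0 <
          70 * t^5 + 173 * s * t^4 + 153 * s^2 * t^3 + 58 * s^3 * t^2 + 8 * s^4 * t + 207 *
          q * t^4 + 399 * q * s * t^3 + 259 * q * s^2 * t^2 + 64 * q * s^3 * t + 4 * q * s^4
          + 224 * q^2 * t^3 + 318 * q^2 * s * t^2 + 135 * q^2 * s^2 * t + 16 * q^2 * s^3 +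
          105 * q^3 * t^2 + 99 * q^3 * s * t + 21 * q^3 * s^2 + 18 * q^4 * t + 9 * q^4 * s := by
          rcases hst with hs | ht <;> positivity
        linarith
      · obtain ⟨q, s, t, hq, hs, ht, hst, rfl, rfl, rfl⟩ :=
          exists_ordered_triangle_param c a b (by assumption) (by assumption) (by linarith)
            (by rintro ⟨h₁, h₂⟩; exact hne ⟨by linarith, by linarith⟩)
        refine lt_of_lt_of_le ?_ (hM _ hb hbM)
        have key : 0 <
          70 * t^5 + 177 * s * t^4 + 161 * s^2 * t^3 + 63 * s^3 * t^2 + 9 * s^4 * t + 207 *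
          q * t^4 + 429 * q * s * t^3 + 304 * q * s^2 * t^2 + 85 * q * s^3 * t + 7 * q * s^4
          + 224 * q^2 * t^3 + 354 * q^2 * s * t^2 + 171 * q^2 * s^2 * t + 25 * q^2 * s^3 +
          105 * q^3 * t^2 + 111 * q^3 * s * t + 27 * q^3 * s^2 + 18 * q^4 * t + 9 * q^4 * s := by
          rcases hst with hs | ht <;> positivity
        linarith
  · rcases le_total a c with h₂ | h₂
    · obtain ⟨q, s, t, hq, hs, ht, hst, rfl, rfl, rfl⟩ :=
        exists_ordered_triangle_param b a c (by assumption) (by assumption) (by linarith)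
          (by rintro ⟨h₁, h₂⟩; exact hne ⟨by linarith, by linarith⟩)
      refine lt_of_lt_of_le ?_ (hM _ hc hcM)
      have key : 0 <
        40 * t^5 + 116 * s * t^4 + 120 * s^2 * t^3 + 52 * s^3 * t^2 + 8 * s^4 * t + 114 *
        q * t^4 + 246 * q * s * t^3 + 184 * q * s^2 * t^2 + 52 * q * s^3 * t + 4 * q * s^4
        + 119 * q^2 * t^3 + 171 * q^2 * s * t^2 + 78 * q^2 * s^2 * t + 10 * q^2 * s^3 + 54
        * q^3 * t^2 + 39 * q^3 * s * t + 6 * q^3 * s^2 + 9 * q^4 * t := by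
        rcases hst with hs | ht <;> positivity
      linarith
    · rcases le_total b c with h₃ | h₃
      · obtain ⟨q, s, t, hq, hs, ht, hst, rfl, rfl, rfl⟩ :=
          exists_ordered_triangle_param b c a (by assumption) (by assumption) (by linarith)
            (by rintro ⟨h₁, h₂⟩; exact hne ⟨by linarith, by linarith⟩)
        refine lt_of_lt_of_le ?_ (hM _ ha haM)
        have key : 0 <
          22 * t^5 + 45 * s * t^4 + 29 * s^2 * t^3 + 6 * s^3 * t^2 + 75 * q * t^4 + 117 * q
          * s * t^3 + 67 * q * s^2 * t^2 + 22 * q * s^3 * t + 4 * q * s^4 + 92 * q^2 * t^3 +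
          99 * q^2 * s * t^2 + 42 * q^2 * s^2 * t + 10 * q^2 * s^3 + 48 * q^3 * t^2 + 27 *
          q^3 * s * t + 6 * q^3 * s^2 + 9 * q^4 * t := by
          rcases hst with hs | ht <;> positivity
        linarith
      · obtain ⟨q, s, t, hq, hs, ht, hst, rfl, rfl, rfl⟩ :=
          exists_ordered_triangle_param c b a (by assumption) (by assumption) (by linarith)
            (by rintro ⟨h₁, h₂⟩; exact hne ⟨by linarith, by linarith⟩)
        refine lt_of_lt_of_le ?_ (hM _ ha haM)
        have key : 0 <
          22 * t^5 + 65 * s * t^4 + 69 * s^2 * t^3 + 31 * s^3 * t^2 + 5 * s^4 * t + 75 * q *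
          t^4 + 183 * q * s * t^3 + 166 * q * s^2 * t^2 + 61 * q * s^3 * t + 7 * q * s^4 +
          92 * q^2 * t^3 + 177 * q^2 * s * t^2 + 120 * q^2 * s^2 * t + 25 * q^2 * s^3 + 48 *
          q^3 * t^2 + 69 * q^3 * s * t + 27 * q^3 * s^2 + 9 * q^4 * t + 9 * q^4 * s := by
          rcases hst with hs | ht <;> positivity
        linarith

/-- The norm estimate behind one coordinate of the transformation, for three vectors with sum zero
that are pairwise on different rays and do not all have the same norm. -/
lemma norm_theta_aux_lt {E : Type*} [NormedAddCommGroup E] [InnerProductSpace ℝ E] {u v w : E}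
    (h : u + v + w = 0) (huv : ¬ SameRay ℝ u v) (hvw : ¬ SameRay ℝ v w) (hwu : ¬ SameRay ℝ w u)
    (hne : ¬ (‖u‖ = ‖v‖ ∧ ‖v‖ = ‖w‖)) {M : ℝ} (hu : ‖u‖ ≤ M) (hv : ‖v‖ ≤ M) (hw : ‖w‖ ≤ M) :
    ‖(3 : ℝ)⁻¹ • ((2 * (‖w‖ / ‖u‖)) • u - (‖u‖ / ‖v‖) • v - (‖v‖ / ‖w‖) • w)‖ < M := by
  have pu : 0 < ‖u‖ := norm_pos_iff.2 fun h0 => huv (h0 ▸ SameRay.zero_left v)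
  have pv : 0 < ‖v‖ := norm_pos_iff.2 fun h0 => hvw (h0 ▸ SameRay.zero_left w)
  have pw : 0 < ‖w‖ := norm_pos_iff.2 fun h0 => hwu (h0 ▸ SameRay.zero_left u)
  have euv : ‖u + v‖ = ‖w‖ := by rw [eq_neg_of_add_eq_zero_left h, norm_neg]
  have evw : ‖v + w‖ = ‖u‖ := by
    rw [eq_neg_of_add_eq_zero_left (show v + w + u = 0 by rw [← h]; abel), norm_neg]
  have ewu : ‖w + u‖ = ‖v‖ := by
    rw [eq_neg_of_add_eq_zero_left (show w + u + v = 0 by rw [← h]; abel), norm_neg]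
  have key := triangle_quintic_lt pu pv pw (euv ▸ norm_add_lt_of_not_sameRay huv)
    (evw ▸ norm_add_lt_of_not_sameRay hvw) (ewu ▸ norm_add_lt_of_not_sameRay hwu) hne hu hv hw
  have iuv := norm_add_sq_real u v
  have ivw := norm_add_sq_real v w
  have iwu := norm_add_sq_real w u
  rw [euv] at iuv
  rw [evw] at ivw
  rw [ewu, real_inner_comm] at iwu
  refine lt_of_pow_lt_pow_left₀ 2 (pu.le.trans hu) ?_
  refine lt_of_mul_lt_mul_right ?_ (show 0 ≤ 9 * (‖u‖ * ‖v‖ * ‖w‖) by positivity)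
  have jv : inner ℝ u v = (‖w‖ ^ 2 - ‖u‖ ^ 2 - ‖v‖ ^ 2) / 2 := by linarith
  have jw : inner ℝ v w = (‖u‖ ^ 2 - ‖v‖ ^ 2 - ‖w‖ ^ 2) / 2 := by linarith
  have ju : inner ℝ u w = (‖v‖ ^ 2 - ‖w‖ ^ 2 - ‖u‖ ^ 2) / 2 := by linarith
  rw [norm_smul, mul_pow, norm_sub_sq_real, norm_sub_sq_real]
  simp only [norm_smul, inner_sub_left, real_inner_smul_left, real_inner_smul_right, jv, jw, ju,
    norm_mul, norm_div, norm_norm, norm_inv, Real.norm_ofNat]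
  refine (Eq.trans_lt ?_ key).trans_eq ?_
  · field_simp
    ring
  · ring

lemma eq_or_eq_add_one_or_eq_sub_one (i j : Fin 3) : j = i ∨ j = i + 1 ∨ j = i - 1 := by
  revert i j
  decide

lemma sub_centroid_sum {E : Type*} [NormedAddCommGroup E] [NormedSpace ℝ E] (x : Fin 3 → E)
    (i : Fin 3) :
    x i - centroid x + (x (i + 1) - centroid x) + (x (i - 1) - centroid x) = 0 := by
  have h : x i + x (i + 1) + x (i - 1) = (3 : ℝ) • centroid x := by
    rw [centroid, smul_inv_smul₀ three_ne_zero]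
    fin_cases i
    · rfl
    · change x 1 + x 2 + x 0 = _
      abel
    · change x 2 + x 0 + x 1 = _
      abel
  rw [show x i - centroid x + (x (i + 1) - centroid x) + (x (i - 1) - centroid x)
    = x i + x (i + 1) + x (i - 1) - (3 : ℝ) • centroid x by module, h, sub_self]

/-- If two of the differences to the centroid lie on a common ray, the points are collinear. -/
lemma collinear_range_of_sameRay_sub_centroid {E : Type*} [NormedAddCommGroup E]
    [NormedSpace ℝ E] (x : Fin 3 → E) (i : Fin 3)
    (h : SameRay ℝ (x i - centroid x) (x (i + 1) - centroid x)) :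
    Collinear ℝ (Set.range x) := by
  obtain ⟨a, b, -, -, -, ha, hb⟩ := h.exists_eq_smul_add
  have hsum := sub_centroid_sum x i
  set d := x i - centroid x + (x (i + 1) - centroid x)
  rw [collinear_iff_exists_forall_eq_smul_vadd]
  refine ⟨centroid x, d, ?_⟩
  rintro _ ⟨j, rfl⟩
  rcases eq_or_eq_add_one_or_eq_sub_one i j with rfl | rfl | rfl
  · exact ⟨a, by rw [← ha]; simp⟩
  · exact ⟨b, by rw [← hb]; simp⟩
  · exact ⟨-1, by rw [neg_one_smul, ← eq_neg_of_add_eq_zero_right hsum]; simp⟩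

/-- Under one application of the geometric triangle transformation, the maximal
distance from the vertices to the centroid strictly decreases (for a non-equilateral
triangle); here `c = centroid x` is also the centroid of `θ(Δ)`. -/
theorem theta_max_dist_strict_decrease
    (x : Fin 3 → EuclideanSpace ℝ (Fin 2)) (hx : IsTriangle x)
    (hne : ¬ (‖x 0 - centroid x‖ = ‖x 1 - centroid x‖ ∧
        ‖x 1 - centroid x‖ = ‖x 2 - centroid x‖)) :
    max (max ‖theta x 0 - centroid x‖ ‖theta x 1 - centroid x‖)
        ‖theta x 2 - centroid x‖
      < max (max ‖x 0 - centroid x‖ ‖x 1 - centroid x‖) ‖x 2 - centroid x‖ := by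
  have hray : ∀ i, ¬ SameRay ℝ (x i - centroid x) (x (i + 1) - centroid x) :=
    fun i h => hx (collinear_range_of_sameRay_sub_centroid x i h)
  have hle : ∀ i, ‖x i - centroid x‖ ≤
      max (max ‖x 0 - centroid x‖ ‖x 1 - centroid x‖) ‖x 2 - centroid x‖ := by
    intro i
    fin_cases i <;> simp
  have hlt : ∀ i, ‖theta x i - centroid x‖ <
      max (max ‖x 0 - centroid x‖ ‖x 1 - centroid x‖) ‖x 2 - centroid x‖ := by
    intro i
    have h₁ : i + 1 - 1 = i := by simp
    have h₂ : i - 1 - 1 = i + 1 := by revert i; decide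
    have h₃ : i + 1 + 1 = i - 1 := by revert i; decide
    have h₄ : i - 1 + 1 = i := by simp
    have hne' : ¬ (‖x i - centroid x‖ = ‖x (i + 1) - centroid x‖ ∧
        ‖x (i + 1) - centroid x‖ = ‖x (i - 1) - centroid x‖) := by
      rintro ⟨e₁, e₂⟩
      have e : ∀ j, ‖x j - centroid x‖ = ‖x i - centroid x‖ := by
        intro j
        rcases eq_or_eq_add_one_or_eq_sub_one i j with rfl | rfl | rfl
        exacts [rfl, e₁.symm, (e₁.trans e₂).symm]
      exact hne ⟨(e 0).trans (e 1).symm, (e 1).trans (e 2).symm⟩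
    have := norm_theta_aux_lt (sub_centroid_sum x i) (hray i) (h₃ ▸ hray (i + 1))
      (by simpa only [h₄] using hray (i - 1)) hne' (hle _) (hle _) (hle _)
    simpa only [theta, tratio, add_sub_cancel_right, h₁, h₂] using this
  exact max_lt (max_lt (hlt 0) (hlt 1)) (hlt 2)
end

section
/- (Theorem 2.3) Let Δ be a triangle in ℝ² with centroid c, and suppose that for every n ≥ 0 the iterate θⁿ(Δ) = (x₀⁽ⁿ⁾, x₁⁽ⁿ⁾, x₂⁽ⁿ⁾) is again a triangle (so θⁿ(Δ) is defined for all n; note that θ preserves the centroid, so c is the centroid of every iterate). Then the iterates converge to an equilateral shape: for each i ∈ ℤ₃, the ratio rᵢ⁽ⁿ⁾ = ‖x_{i−1}⁽ⁿ⁾−c‖ / ‖xᵢ⁽ⁿ⁾−c‖ converges to 1 as n → ∞. -/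
open Filter Topology

lemma three_le_of_mul_eq_one {r s t : ℝ} (hr : 0 < r) (hs : 0 < s) (ht : 0 < t)
    (h1 : r * s * t = 1) : 3 ≤ r * s + s * t + t * r := by
  have hp := mul_pos hs ht
  have hq := mul_pos hr hs
  have hu := mul_pos ht hr
  have hprod : (s * t) * (r * s) * (t * r) = 1 := by
    linear_combination (r * s * t + 1) * h1
  generalize s * t = p at *
  generalize r * s = q at *
  generalize t * r = u at *
  have hkey : 4 ≤ p * (q + u) ^ 2 := by nlinarith [mul_nonneg hp.le (sq_nonneg (q - u))]
  by_contra! h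
  have : p * (q + u) ^ 2 < p * (3 - p) ^ 2 := by gcongr; linarith
  nlinarith [mul_nonneg (sq_nonneg (p - 1)) (show 0 ≤ 4 - p by linarith)]

lemma tendsto_one_of_mul_eq_one_of_tendsto_three {r s t : ℕ → ℝ}
    (hr : ∀ n, 0 < r n) (hs : ∀ n, 0 < s n) (ht : ∀ n, 0 < t n)
    (h1 : ∀ n, r n * s n * t n = 1)
    (h3 : Tendsto (fun n => r n * s n + s n * t n + t n * r n) atTop (𝓝 3)) :
    Tendsto r atTop (𝓝 1) := by
  have hT : Tendsto (fun n => 2 * (r n * s n + s n * t n + t n * r n) *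
      ((r n * s n + s n * t n + t n * r n) - 3) * ((r n * s n + s n * t n + t n * r n) + 3))
      atTop (𝓝 0) := by
    have := ((h3.const_mul 2).mul (h3.sub_const 3)).mul (h3.add_const 3)
    simpa using this
  have hsq : Tendsto (fun n => (s n * t n - 1) ^ 2) atTop (𝓝 0) := by
    refine squeeze_zero' (Eventually.of_forall fun n => sq_nonneg _) ?_ hT
    filter_upwards [h3.eventually_le_const (show (3 : ℝ) < 7 / 2 by norm_num)] with n hn
    have h1 := h1 n
    have hT3 := three_le_of_mul_eq_one (hr n) (hs n) (ht n) h1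
    have hp := mul_pos (hs n) (ht n)
    have hq := mul_pos (hr n) (hs n)
    have hu := mul_pos (ht n) (hr n)
    have hprod : (s n * t n) * (r n * s n) * (t n * r n) = 1 := by
      linear_combination (r n * s n * t n + 1) * h1
    generalize s n * t n = p at *
    generalize r n * s n = q at *
    generalize t n * r n = u at *
    have hkey : 4 ≤ p * (q + u) ^ 2 := by nlinarith [mul_nonneg hp.le (sq_nonneg (q - u))]
    obtain ⟨T, hTdef⟩ : ∃ T, T = q + p + u := ⟨_, rfl⟩
    rw [← hTdef] at hn hT3 ⊢
    have hqu : q + u = T - p := by rw [hTdef]; ring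
    rw [hqu] at hkey
    have hpT : p < T := by linarith
    have hmain : (p - 1) ^ 2 * (4 - p) ≤ p * (T - 3) * (T + 3 - 2 * p) := by
      linear_combination hkey
    have h6 : p * (T - 3) * (T + 3 - 2 * p) ≤ T * (T - 3) * (T + 3) := by
      have : p * (T - 3) ≤ T * (T - 3) := by gcongr
      have h0 : 0 ≤ p * (T - 3) := mul_nonneg hp.le (by linarith)
      calc _ ≤ p * (T - 3) * (T + 3) := by gcongr; linarith
        _ ≤ _ := by gcongr
    nlinarith [mul_nonneg (sq_nonneg (p - 1)) (show 0 ≤ 7 / 2 - p by linarith)]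
  have hp : Tendsto (fun n => s n * t n) atTop (𝓝 1) := by
    have := (tendsto_zero_iff_abs_tendsto_zero _).2
      (show Tendsto (fun n => |s n * t n - 1|) atTop (𝓝 0) by
        simpa [Real.sqrt_sq_eq_abs] using hsq.sqrt)
    simpa using this.add_const 1
  have hr' : r = fun n => (s n * t n)⁻¹ := by
    ext n
    exact eq_inv_of_mul_eq_one_left (by rw [← h1 n]; ring)
  rw [hr']
  simpa using hp.inv₀ one_ne_zero

lemma centroid_theta {E : Type*} [NormedAddCommGroup E] [NormedSpace ℝ E] (x : Fin 3 → E) :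
    centroid (theta x) = centroid x := by
  have h : ∀ c : E, centroid (fun i => (3 : ℝ)⁻¹ • ((2 * tratio x i) • (x i - c)
      - tratio x (i + 1) • (x (i + 1) - c) - tratio x (i - 1) • (x (i - 1) - c)) + c) = c := by
    intro c
    simp only [centroid, show (0 : Fin 3) + 1 = 1 from rfl, show (1 : Fin 3) + 1 = 2 from rfl,
      show (2 : Fin 3) + 1 = 0 from rfl, show (0 : Fin 3) - 1 = 2 from rfl,
      show (1 : Fin 3) - 1 = 0 from rfl, show (2 : Fin 3) - 1 = 1 from rfl]
    module
  exact h _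

/-- Two thirds of the signed area of the triangle `x`, as a cross product based at the centroid. -/
noncomputable def crossAtCentroid (x : Fin 3 → EuclideanSpace ℝ (Fin 2)) : ℝ :=
  (x 0 - centroid x) 0 * (x 1 - centroid x) 1 - (x 0 - centroid x) 1 * (x 1 - centroid x) 0

/-- The sum of the squared distances from the vertices to the centroid. -/
noncomputable def centroidEnergy (x : Fin 3 → EuclideanSpace ℝ (Fin 2)) : ℝ :=
  ‖x 0 - centroid x‖ ^ 2 + ‖x 1 - centroid x‖ ^ 2 + ‖x 2 - centroid x‖ ^ 2

lemma sum_sub_centroid {E : Type*} [NormedAddCommGroup E] [NormedSpace ℝ E] (x : Fin 3 → E) :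
    (x 0 - centroid x) + (x 1 - centroid x) + (x 2 - centroid x) = 0 := by
  simp only [centroid]
  module

lemma theta_sub_centroid {E : Type*} [NormedAddCommGroup E] [NormedSpace ℝ E]
    (x : Fin 3 → E) (i : Fin 3) :
    theta x i - centroid (theta x) = (3 : ℝ)⁻¹ • ((2 * tratio x i) • (x i - centroid x)
      - tratio x (i + 1) • (x (i + 1) - centroid x)
      - tratio x (i - 1) • (x (i - 1) - centroid x)) := by
  rw [centroid_theta]
  simp [theta]

lemma crossAtCentroid_theta (x : Fin 3 → EuclideanSpace ℝ (Fin 2)) :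
    crossAtCentroid (theta x) = crossAtCentroid x *
      ((tratio x 0 * tratio x 1 + tratio x 1 * tratio x 2 + tratio x 2 * tratio x 0) / 3) := by
  have h2 : x 2 - centroid x = -(x 0 - centroid x) - (x 1 - centroid x) := by
    rw [eq_sub_iff_add_eq, eq_neg_iff_add_eq_zero, ← sum_sub_centroid x]; abel
  simp only [crossAtCentroid, theta_sub_centroid, zero_add, show (1 : Fin 3) + 1 = 2 from rfl,
    show (0 : Fin 3) - 1 = 2 from rfl, show (1 : Fin 3) - 1 = 0 from rfl, h2]
  generalize x 0 - centroid x = v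
  generalize x 1 - centroid x = w
  simp only [PiLp.smul_apply, PiLp.sub_apply, PiLp.neg_apply, smul_eq_mul]
  ring

lemma centroidEnergy_theta_le {x : Fin 3 → EuclideanSpace ℝ (Fin 2)}
    (hx : ∀ i, x i - centroid x ≠ 0) : centroidEnergy (theta x) ≤ centroidEnergy x := by
  have hr : ∀ i, ‖x (i - 1) - centroid x‖ = ‖tratio x i • (x i - centroid x)‖ := by
    intro i
    have := norm_ne_zero_iff.2 (hx i)
    rw [norm_smul, tratio, norm_div, norm_norm, norm_norm, div_mul_cancel₀ _ this]
  have h0 := hr 0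
  have h1 := hr 1
  have h2 := hr 2
  simp only [show (0 : Fin 3) - 1 = 2 from rfl, show (1 : Fin 3) - 1 = 0 from rfl,
    show (2 : Fin 3) - 1 = 1 from rfl] at h0 h1 h2
  simp only [centroidEnergy, theta_sub_centroid, zero_add, show (1 : Fin 3) + 1 = 2 from rfl,
    show (2 : Fin 3) + 1 = 0 from rfl, show (2 : Fin 3) - 1 = 1 from rfl,
    show (0 : Fin 3) - 1 = 2 from rfl, show (1 : Fin 3) - 1 = 0 from rfl, h0, h1, h2, mul_smul]
  generalize tratio x 0 • (x 0 - centroid x) = u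
  generalize tratio x 1 • (x 1 - centroid x) = v
  generalize tratio x 2 • (x 2 - centroid x) = w
  simp only [EuclideanSpace.real_norm_sq_eq, Fin.sum_univ_two, PiLp.smul_apply, PiLp.sub_apply,
    smul_eq_mul]
  nlinarith [sq_nonneg (u 0 + v 0 + w 0), sq_nonneg (u 1 + v 1 + w 1)]

lemma abs_crossAtCentroid_le (x : Fin 3 → EuclideanSpace ℝ (Fin 2)) :
    |crossAtCentroid x| ≤ centroidEnergy x := by
  simp only [crossAtCentroid, centroidEnergy]
  generalize x 0 - centroid x = u
  generalize x 1 - centroid x = v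
  generalize x 2 - centroid x = w
  simp only [EuclideanSpace.real_norm_sq_eq, Fin.sum_univ_two]
  rw [abs_le]
  constructor <;>
  nlinarith [sq_nonneg (u 0 + v 1), sq_nonneg (u 0 - v 1), sq_nonneg (u 1 + v 0),
    sq_nonneg (u 1 - v 0), sq_nonneg (w 0), sq_nonneg (w 1), sq_nonneg (u 0), sq_nonneg (u 1),
    sq_nonneg (v 0), sq_nonneg (v 1)]

lemma IsTriangle.crossAtCentroid_ne_zero {x : Fin 3 → EuclideanSpace ℝ (Fin 2)}
    (hx : IsTriangle x) : crossAtCentroid x ≠ 0 := by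
  intro h
  apply hx
  rw [collinear_iff_exists_forall_eq_smul_vadd]
  have hsum := sum_sub_centroid x
  have key : ∃ u : EuclideanSpace ℝ (Fin 2), ∃ a b : ℝ,
      x 0 - centroid x = a • u ∧ x 1 - centroid x = b • u := by
    rw [crossAtCentroid] at h
    generalize x 0 - centroid x = v at h
    generalize x 1 - centroid x = w at h
    by_cases hv : v = 0
    · exact ⟨w, 0, 1, by simp [hv], by simp⟩
    · refine ⟨v, 1, ?_⟩
      by_cases h0 : v 0 = 0
      · have h1 : v 1 ≠ 0 := fun h1 => hv (by ext i; fin_cases i <;> simp [h0, h1])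
        refine ⟨w 1 / v 1, by simp, ?_⟩
        ext i
        fin_cases i
        · simp [h0, h1] at h ⊢; exact h
        · simp [h1]
      · refine ⟨w 0 / v 0, by simp, ?_⟩
        ext i
        fin_cases i
        · simp [h0]
        · simp; field_simp; linarith
  obtain ⟨u, a, b, ha, hb⟩ := key
  have hc : x 2 - centroid x = (-(a + b)) • u := by
    rw [ha, hb] at hsum
    rw [neg_smul, add_smul]
    exact (neg_eq_of_add_eq_zero_right hsum).symm
  refine ⟨centroid x, u, ?_⟩
  rintro _ ⟨i, rfl⟩
  fin_cases i
  · exact ⟨a, by simp [← ha]⟩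
  · exact ⟨b, by simp [← hb]⟩
  · exact ⟨-(a + b), by rw [← hc]; simp⟩

lemma sub_centroid_ne_zero {x : Fin 3 → EuclideanSpace ℝ (Fin 2)}
    (hx : crossAtCentroid x ≠ 0) (i : Fin 3) : x i - centroid x ≠ 0 := by
  intro h
  apply hx
  have hsum := sum_sub_centroid x
  rw [crossAtCentroid]
  fin_cases i
  · have h : x 0 - centroid x = 0 := h
    simp only [h, PiLp.zero_apply]; ring
  · have h : x 1 - centroid x = 0 := h
    simp only [h, PiLp.zero_apply]; ring
  · have h : x 2 - centroid x = 0 := h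
    rw [h, add_zero] at hsum
    rw [eq_neg_of_add_eq_zero_right hsum]
    simp only [PiLp.neg_apply]; ring

lemma tratio_mul_tratio_mul_tratio {E : Type*} [NormedAddCommGroup E] [NormedSpace ℝ E]
    {x : Fin 3 → E} (hx : ∀ i, x i - centroid x ≠ 0) :
    tratio x 0 * tratio x 1 * tratio x 2 = 1 := by
  have h0 := norm_ne_zero_iff.2 (hx 0)
  have h1 := norm_ne_zero_iff.2 (hx 1)
  have h2 := norm_ne_zero_iff.2 (hx 2)
  simp only [tratio, show (0 : Fin 3) - 1 = 2 from rfl, show (1 : Fin 3) - 1 = 0 from rfl,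
    show (2 : Fin 3) - 1 = 1 from rfl]
  field_simp

/-- (Theorem 2.3) If all iterates `θⁿ(Δ)` of a triangle `Δ` are again triangles, then
the ratios `rᵢ⁽ⁿ⁾ = ‖x_{i−1}⁽ⁿ⁾−c‖/‖xᵢ⁽ⁿ⁾−c‖` converge to `1`, i.e. the iterates
converge to an equilateral shape.  (θ preserves the centroid, so `c` is also the
centroid of every iterate.) -/
theorem theta_iterates_ratios_tendsto_one
    (x : Fin 3 → EuclideanSpace ℝ (Fin 2))
    (hx : ∀ n : ℕ, IsTriangle (theta^[n] x)) :
    ∀ i : Fin 3,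
      Filter.Tendsto (fun n : ℕ => tratio (theta^[n] x) i) Filter.atTop (nhds 1) := by
  have hD := fun n => (hx n).crossAtCentroid_ne_zero
  have hne := fun n => sub_centroid_ne_zero (hD n)
  have hpos : ∀ i n, 0 < tratio (theta^[n] x) i := fun i n =>
    div_pos (norm_pos_iff.2 (hne n _)) (norm_pos_iff.2 (hne n _))
  have hone := fun n => tratio_mul_tratio_mul_tratio (hne n)
  set A : ℕ → ℝ := fun n => |crossAtCentroid (theta^[n] x)| with hA
  set T : ℕ → ℝ := fun n => tratio (theta^[n] x) 0 * tratio (theta^[n] x) 1 +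
    tratio (theta^[n] x) 1 * tratio (theta^[n] x) 2 +
    tratio (theta^[n] x) 2 * tratio (theta^[n] x) 0 with hT
  have hT3 : ∀ n, 3 ≤ T n := fun n =>
    three_le_of_mul_eq_one (hpos 0 n) (hpos 1 n) (hpos 2 n) (hone n)
  have hApos : ∀ n, 0 < A n := fun n => abs_pos.2 (hD n)
  have hAsucc : ∀ n, A (n + 1) = A n * (T n / 3) := by
    intro n
    simp only [hA, Function.iterate_succ_apply', crossAtCentroid_theta, abs_mul]
    rw [abs_of_pos (a := _ / 3) (by linarith [hT3 n])]
  have hmono : Monotone A := monotone_nat_of_le_succ fun n => by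
    rw [hAsucc]
    exact le_mul_of_one_le_right (hApos n).le (by linarith [hT3 n])
  have hanti : Antitone fun n => centroidEnergy (theta^[n] x) := antitone_nat_of_succ_le fun n => by
    rw [Function.iterate_succ_apply']
    exact centroidEnergy_theta_le (hne n)
  have hbdd : BddAbove (Set.range A) := ⟨centroidEnergy (theta^[0] x), by
    rintro _ ⟨n, rfl⟩
    exact (abs_crossAtCentroid_le _).trans (hanti (Nat.zero_le n))⟩
  have hlim := tendsto_atTop_ciSup hmono hbdd
  have hL : (⨆ n, A n) ≠ 0 := ((hApos 0).trans_le (le_ciSup hbdd 0)).ne'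
  have hTlim : Tendsto T atTop (𝓝 3) := by
    have h := (((tendsto_add_atTop_iff_nat 1).2 hlim).div hlim hL).const_mul 3
    rw [div_self hL, mul_one] at h
    refine h.congr fun n => ?_
    have := (hApos n).ne'
    simp only [Pi.div_apply, hAsucc]
    field_simp
  intro i
  obtain rfl | rfl | rfl : i = 0 ∨ i = 1 ∨ i = 2 := by fin_cases i <;> simp
  · exact tendsto_one_of_mul_eq_one_of_tendsto_three (hpos 0) (hpos 1) (hpos 2) hone hTlim
  · exact tendsto_one_of_mul_eq_one_of_tendsto_three (hpos 1) (hpos 2) (hpos 0)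
      (fun n => by rw [← hone n]; ring) (hTlim.congr fun n => by simp only [hT]; ring)
  · exact tendsto_one_of_mul_eq_one_of_tendsto_three (hpos 2) (hpos 0) (hpos 1)
      (fun n => by rw [← hone n]; ring) (hTlim.congr fun n => by simp only [hT]; ring)
end

section
/- (Theorem 2.4) Let Δ be a triangle in ℝ² such that all iterates θⁿ(Δ) = (x₀⁽ⁿ⁾, x₁⁽ⁿ⁾, x₂⁽ⁿ⁾) are defined (are triangles). Then the sequence of iterates converges at exponential rate to an equilateral triangle: there exist a triple (y₀,y₁,y₂) of points of ℝ² forming an equilateral triangle and constants C > 0 and μ ∈ (0,1) such that for all n ≥ 0 and all i ∈ {0,1,2}, ‖xᵢ⁽ⁿ⁾ − yᵢ‖ ≤ C·μⁿ. -/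
/-- One third of the cross product of two sides of a triple of points of the plane. -/
noncomputable def centralCross (x : Fin 3 → EuclideanSpace ℝ (Fin 2)) : ℝ :=
  ((x 1 0 - x 0 0) * (x 2 1 - x 0 1) - (x 1 1 - x 0 1) * (x 2 0 - x 0 0)) / 3

/-- The sum of the squared distances of the vertices to the centroid. -/
noncomputable def centralEnergy (x : Fin 3 → EuclideanSpace ℝ (Fin 2)) : ℝ :=
  ‖x 0 - centroid x‖ ^ 2 + ‖x 1 - centroid x‖ ^ 2 + ‖x 2 - centroid x‖ ^ 2

/-- The sum of the squared differences of the distances of the vertices to the centroid. -/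
noncomputable def centralSpread (x : Fin 3 → EuclideanSpace ℝ (Fin 2)) : ℝ :=
  (‖x 0 - centroid x‖ - ‖x 1 - centroid x‖) ^ 2
    + (‖x 1 - centroid x‖ - ‖x 2 - centroid x‖) ^ 2
    + (‖x 2 - centroid x‖ - ‖x 0 - centroid x‖) ^ 2

/-- The isoperimetric deficit, which vanishes exactly on equilateral triples. -/
noncomputable def equilateralDeficit (x : Fin 3 → EuclideanSpace ℝ (Fin 2)) : ℝ :=
  centralEnergy x - 2 * √3 * |centralCross x|

theorem collinear_of_centralCross_eq_zero {x : Fin 3 → EuclideanSpace ℝ (Fin 2)}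
    (h : centralCross x = 0) : Collinear ℝ (Set.range x) := by
  have h' : (x 1 0 - x 0 0) * (x 2 1 - x 0 1) = (x 1 1 - x 0 1) * (x 2 0 - x 0 0) := by
    unfold centralCross at h; linarith
  rw [collinear_iff_of_mem (Set.mem_range_self (0 : Fin 3))]
  by_cases h0 : x 1 0 - x 0 0 = 0
  · by_cases h1 : x 1 1 - x 0 1 = 0
    · refine ⟨x 2 - x 0, ?_⟩
      rintro _ ⟨i, rfl⟩
      fin_cases i
      · exact ⟨0, by simp⟩
      · refine ⟨0, ?_⟩
        ext k
        fin_cases k <;> simp <;> linarith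
      · exact ⟨1, by simp⟩
    · refine ⟨x 1 - x 0, ?_⟩
      rintro _ ⟨i, rfl⟩
      fin_cases i
      · exact ⟨0, by simp⟩
      · exact ⟨1, by simp⟩
      · refine ⟨(x 2 1 - x 0 1) / (x 1 1 - x 0 1), ?_⟩
        ext k
        fin_cases k <;> simp <;> field_simp <;> linarith
  · refine ⟨x 1 - x 0, ?_⟩
    rintro _ ⟨i, rfl⟩
    fin_cases i
    · exact ⟨0, by simp⟩
    · exact ⟨1, by simp⟩
    · refine ⟨(x 2 0 - x 0 0) / (x 1 0 - x 0 0), ?_⟩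
      ext k
      fin_cases k <;> simp <;> field_simp <;> linarith

theorem centralCross_eq_zero_of_collinear {x : Fin 3 → EuclideanSpace ℝ (Fin 2)}
    (h : Collinear ℝ (Set.range x)) : centralCross x = 0 := by
  rw [collinear_iff_of_mem (Set.mem_range_self (0 : Fin 3))] at h
  obtain ⟨v, hv⟩ := h
  obtain ⟨r, hr⟩ := hv (x 1) (Set.mem_range_self 1)
  obtain ⟨s, hs⟩ := hv (x 2) (Set.mem_range_self 2)
  unfold centralCross
  rw [hr, hs]
  simp
  ring

theorem isTriangle_iff_centralCross_ne_zero {x : Fin 3 → EuclideanSpace ℝ (Fin 2)} :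
    IsTriangle x ↔ centralCross x ≠ 0 :=
  not_congr ⟨centralCross_eq_zero_of_collinear, collinear_of_centralCross_eq_zero⟩

theorem centralEnergy_sq (x : Fin 3 → EuclideanSpace ℝ (Fin 2)) :
    centralEnergy x ^ 2 = 12 * centralCross x ^ 2
      + 2 * ((‖x 0 - centroid x‖ ^ 2 - ‖x 1 - centroid x‖ ^ 2) ^ 2
        + (‖x 1 - centroid x‖ ^ 2 - ‖x 2 - centroid x‖ ^ 2) ^ 2
        + (‖x 2 - centroid x‖ ^ 2 - ‖x 0 - centroid x‖ ^ 2) ^ 2) := by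
  simp only [centralEnergy, centralCross, EuclideanSpace.real_norm_sq_eq, Fin.sum_univ_two,
    centroid, PiLp.sub_apply, PiLp.smul_apply, PiLp.add_apply, smul_eq_mul]
  ring

theorem norm_sub_centroid_pos {x : Fin 3 → EuclideanSpace ℝ (Fin 2)}
    (h : centralCross x ≠ 0) (i : Fin 3) : 0 < ‖x i - centroid x‖ := by
  rw [norm_pos_iff]
  intro h0
  apply h
  have hk (k : Fin 2) : x i k = (x 0 k + x 1 k + x 2 k) / 3 := by
    have := congrArg (fun v : EuclideanSpace ℝ (Fin 2) => v k) h0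
    simp [centroid] at this
    linarith
  have e0 := hk 0
  have e1 := hk 1
  unfold centralCross
  fin_cases i <;> simp at e0 e1
  · have a0 : x 2 0 = 2 * x 0 0 - x 1 0 := by linarith
    have a1 : x 2 1 = 2 * x 0 1 - x 1 1 := by linarith
    rw [a0, a1]; ring
  · have a0 : x 2 0 = 2 * x 1 0 - x 0 0 := by linarith
    have a1 : x 2 1 = 2 * x 1 1 - x 0 1 := by linarith
    rw [a0, a1]; ring
  · have a0 : x 1 0 = 2 * x 2 0 - x 0 0 := by linarith
    have a1 : x 1 1 = 2 * x 2 1 - x 0 1 := by linarith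
    rw [a0, a1]; ring

theorem centralEnergy_pos {x : Fin 3 → EuclideanSpace ℝ (Fin 2)}
    (h : centralCross x ≠ 0) : 0 < centralEnergy x := by
  have := norm_sub_centroid_pos h
  have h0 := this 0
  have h1 := this 1
  have h2 := this 2
  unfold centralEnergy
  positivity

/-- A quantitative form of the inequality of means for a cyclic product of ratios. -/
theorem cyclic_ratio_sum_sub_three_ge {a b c : ℝ} (ha : 0 < a) (hb : 0 < b) (hc : 0 < c) :
    ((a - b) ^ 2 + (b - c) ^ 2 + (c - a) ^ 2) / (a ^ 2 + b ^ 2 + c ^ 2)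
      ≤ c / b + a / c + b / a - 3 := by
  have key : ∀ {a b c : ℝ}, 0 < a → a ≤ b → a ≤ c →
      ((a - b) ^ 2 + (b - c) ^ 2 + (c - a) ^ 2) / (a ^ 2 + b ^ 2 + c ^ 2)
        ≤ c / b + a / c + b / a - 3 := by
    intro a b c ha hab hac
    have hb : 0 < b := ha.trans_le hab
    have hc : 0 < c := ha.trans_le hac
    have e : c / b + a / c + b / a - 3
        = ((a - b) ^ 2 + (b - c) ^ 2 + (c - a) ^ 2) / (2 * b * c)
          + (b - a) ^ 2 * (c - a) / (a * b * c) := by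
      field_simp
      ring
    have h1 : 0 ≤ (b - a) ^ 2 * (c - a) / (a * b * c) := by
      have : 0 ≤ c - a := by linarith
      positivity
    have h2 : ((a - b) ^ 2 + (b - c) ^ 2 + (c - a) ^ 2) / (a ^ 2 + b ^ 2 + c ^ 2)
        ≤ ((a - b) ^ 2 + (b - c) ^ 2 + (c - a) ^ 2) / (2 * b * c) := by
      apply div_le_div_of_nonneg_left (by positivity) (by positivity)
      nlinarith [sq_nonneg (b - c), sq_nonneg a]
    linarith
  rcases le_total a b with hab | hab
  · rcases le_total a c with hac | hac
    · exact key ha hab hac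
    · have := key hc hac (hac.trans hab)
      convert this using 1 <;> ring
  · rcases le_total b c with hbc | hbc
    · have := key hb hbc hab
      convert this using 1 <;> ring
    · have := key hc (hbc.trans hab) hbc
      convert this using 1 <;> ring

theorem centralCross_theta {x : Fin 3 → EuclideanSpace ℝ (Fin 2)} (h : centralCross x ≠ 0) :
    centralCross (theta x) = centralCross x *
      ((‖x 2 - centroid x‖ / ‖x 1 - centroid x‖ + ‖x 0 - centroid x‖ / ‖x 2 - centroid x‖
        + ‖x 1 - centroid x‖ / ‖x 0 - centroid x‖) / 3) := by
  have hp := norm_sub_centroid_pos h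
  have h0 := (hp 0).ne'
  have h1 := (hp 1).ne'
  have h2 := (hp 2).ne'
  have e : centralCross (theta x) = centralCross x *
      ((tratio x 0 * tratio x 1 + tratio x 1 * tratio x 2 + tratio x 2 * tratio x 0) / 3) := by
    simp only [centralCross, theta, centroid, PiLp.sub_apply, PiLp.smul_apply, PiLp.add_apply,
      smul_eq_mul, show (0 : Fin 3) - 1 = 2 from rfl, show (1 : Fin 3) - 1 = 0 from rfl,
      show (2 : Fin 3) - 1 = 1 from rfl, show (0 : Fin 3) + 1 = 1 from rfl,
      show (1 : Fin 3) + 1 = 2 from rfl, show (2 : Fin 3) + 1 = 0 from rfl]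
    ring
  rw [e]
  simp only [tratio, show (0 : Fin 3) - 1 = 2 from rfl, show (1 : Fin 3) - 1 = 0 from rfl,
      show (2 : Fin 3) - 1 = 1 from rfl]
  field_simp

theorem tratio_mul_norm {x : Fin 3 → EuclideanSpace ℝ (Fin 2)} (h : centralCross x ≠ 0)
    (i : Fin 3) : tratio x i * ‖x i - centroid x‖ = ‖x (i - 1) - centroid x‖ :=
  div_mul_cancel₀ _ (norm_sub_centroid_pos h i).ne'

theorem centralEnergy_theta_le {x : Fin 3 → EuclideanSpace ℝ (Fin 2)} (h : centralCross x ≠ 0) :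
    centralEnergy (theta x) ≤ centralEnergy x := by
  have e : centralEnergy (theta x) = (tratio x 0 * ‖x 0 - centroid x‖) ^ 2
      + (tratio x 1 * ‖x 1 - centroid x‖) ^ 2 + (tratio x 2 * ‖x 2 - centroid x‖) ^ 2
      - 3⁻¹ * ‖tratio x 0 • (x 0 - centroid x) + tratio x 1 • (x 1 - centroid x)
        + tratio x 2 • (x 2 - centroid x)‖ ^ 2 := by
    simp only [centralEnergy, mul_pow, EuclideanSpace.real_norm_sq_eq, Fin.sum_univ_two,
      theta, centroid, PiLp.sub_apply, PiLp.smul_apply, PiLp.add_apply,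
      smul_eq_mul, show (0 : Fin 3) - 1 = 2 from rfl, show (1 : Fin 3) - 1 = 0 from rfl,
      show (2 : Fin 3) - 1 = 1 from rfl, show (0 : Fin 3) + 1 = 1 from rfl,
      show (1 : Fin 3) + 1 = 2 from rfl, show (2 : Fin 3) + 1 = 0 from rfl]
    ring
  rw [e, tratio_mul_norm h, tratio_mul_norm h, tratio_mul_norm h]
  simp only [centralEnergy, show (0 : Fin 3) - 1 = 2 from rfl, show (1 : Fin 3) - 1 = 0 from rfl,
      show (2 : Fin 3) - 1 = 1 from rfl]
  nlinarith [sq_nonneg ‖tratio x 0 • (x 0 - centroid x) + tratio x 1 • (x 1 - centroid x)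
        + tratio x 2 • (x 2 - centroid x)‖]

theorem abs_centralCross_add_le_theta {x : Fin 3 → EuclideanSpace ℝ (Fin 2)}
    (h : centralCross x ≠ 0) :
    |centralCross x| + |centralCross x| * (centralSpread x / centralEnergy x) / 3
      ≤ |centralCross (theta x)| := by
  have hp := norm_sub_centroid_pos h
  have hc := cyclic_ratio_sum_sub_three_ge (hp 0) (hp 1) (hp 2)
  rw [centralCross_theta h, abs_mul]
  have hD := abs_nonneg (centralCross x)
  have h0 := hp 0
  have h1 := hp 1
  have h2 := hp 2
  rw [abs_of_pos (a := (_ + _ + _) / 3) (by positivity)]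
  unfold centralSpread centralEnergy
  nlinarith [mul_le_mul_of_nonneg_left hc hD]

theorem abs_centralCross_le_theta {x : Fin 3 → EuclideanSpace ℝ (Fin 2)}
    (h : centralCross x ≠ 0) : |centralCross x| ≤ |centralCross (theta x)| := by
  refine le_trans ?_ (abs_centralCross_add_le_theta h)
  have h1 : 0 ≤ centralSpread x := by unfold centralSpread; positivity
  have h2 := (centralEnergy_pos h).le
  have : 0 ≤ |centralCross x| * (centralSpread x / centralEnergy x) / 3 := by positivity
  linarith

theorem deficit_mul_eq (x : Fin 3 → EuclideanSpace ℝ (Fin 2)) :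
    equilateralDeficit x * (centralEnergy x + 2 * √3 * |centralCross x|)
      = 2 * ((‖x 0 - centroid x‖ ^ 2 - ‖x 1 - centroid x‖ ^ 2) ^ 2
        + (‖x 1 - centroid x‖ ^ 2 - ‖x 2 - centroid x‖ ^ 2) ^ 2
        + (‖x 2 - centroid x‖ ^ 2 - ‖x 0 - centroid x‖ ^ 2) ^ 2) := by
  have h3 : √3 ^ 2 = (3 : ℝ) := Real.sq_sqrt (by norm_num)
  have e : equilateralDeficit x * (centralEnergy x + 2 * √3 * |centralCross x|)
      = centralEnergy x ^ 2 - 4 * √3 ^ 2 * |centralCross x| ^ 2 := by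
    unfold equilateralDeficit; ring
  rw [e, h3, sq_abs, centralEnergy_sq]
  ring

theorem deficit_nonneg {x : Fin 3 → EuclideanSpace ℝ (Fin 2)} (h : centralCross x ≠ 0) :
    0 ≤ equilateralDeficit x := by
  have hS := centralEnergy_pos h
  have hpos : 0 < centralEnergy x + 2 * √3 * |centralCross x| := by positivity
  refine nonneg_of_mul_nonneg_left ?_ hpos
  rw [deficit_mul_eq]
  positivity

theorem deficit_le_spread {x : Fin 3 → EuclideanSpace ℝ (Fin 2)} (h : centralCross x ≠ 0) :
    equilateralDeficit x ≤ 4 * centralSpread x := by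
  have hS := centralEnergy_pos h
  have hE := deficit_nonneg h
  have hm := deficit_mul_eq x
  have hX : 0 ≤ 2 * √3 * |centralCross x| := by positivity
  have h1 : equilateralDeficit x * centralEnergy x
      ≤ equilateralDeficit x * (centralEnergy x + 2 * √3 * |centralCross x|) :=
    mul_le_mul_of_nonneg_left (by linarith) hE
  rw [hm] at h1
  refine le_of_mul_le_mul_right (h1.trans ?_) hS
  unfold centralSpread centralEnergy
  generalize ‖x 0 - centroid x‖ = a
  generalize ‖x 1 - centroid x‖ = b
  generalize ‖x 2 - centroid x‖ = c
  nlinarith [mul_nonneg (sq_nonneg (a - b)) (add_nonneg (sq_nonneg (a - b)) (sq_nonneg c)),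
    mul_nonneg (sq_nonneg (b - c)) (add_nonneg (sq_nonneg (b - c)) (sq_nonneg a)),
    mul_nonneg (sq_nonneg (c - a)) (add_nonneg (sq_nonneg (c - a)) (sq_nonneg b)),
    mul_nonneg (sq_nonneg (a - b)) (sq_nonneg c), mul_nonneg (sq_nonneg (b - c)) (sq_nonneg a),
    mul_nonneg (sq_nonneg (c - a)) (sq_nonneg b)]

theorem norm_sub_centroid_le_add (x : Fin 3 → EuclideanSpace ℝ (Fin 2)) (i : Fin 3) :
    ‖x i - centroid x‖ ≤ ‖x (i + 1) - centroid x‖ + ‖x (i - 1) - centroid x‖ := by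
  have e : x i - centroid x = -((x (i + 1) - centroid x) + (x (i - 1) - centroid x)) := by
    fin_cases i <;> ext k <;> simp [centroid, show (0 : Fin 3) - 1 = 2 from rfl,
      show (2 : Fin 3) - 1 = 1 from rfl, show (1 : Fin 3) + 1 = 2 from rfl,
      show (2 : Fin 3) + 1 = 0 from rfl] <;> ring
  rw [e, norm_neg]
  exact norm_add_le _ _

theorem spread_le_deficit {x : Fin 3 → EuclideanSpace ℝ (Fin 2)} (h : centralCross x ≠ 0) :
    centralSpread x ≤ 2 * equilateralDeficit x := by
  have hS := centralEnergy_pos h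
  have hE := deficit_nonneg h
  have hm := deficit_mul_eq x
  have hX : 2 * √3 * |centralCross x| ≤ centralEnergy x := by
    unfold equilateralDeficit at hE; linarith
  have h1 : equilateralDeficit x * (centralEnergy x + 2 * √3 * |centralCross x|)
      ≤ equilateralDeficit x * (2 * centralEnergy x) :=
    mul_le_mul_of_nonneg_left (by linarith) hE
  rw [hm] at h1
  refine le_of_mul_le_mul_right (?_ : _ ≤ _ * centralEnergy x) hS
  refine le_trans ?_ (h1.trans_eq (by ring))
  have t0 : ‖x 0 - centroid x‖ ≤ ‖x 1 - centroid x‖ + ‖x 2 - centroid x‖ :=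
    norm_sub_centroid_le_add x 0
  have t1 : ‖x 1 - centroid x‖ ≤ ‖x 2 - centroid x‖ + ‖x 0 - centroid x‖ :=
    norm_sub_centroid_le_add x 1
  have t2 : ‖x 2 - centroid x‖ ≤ ‖x 0 - centroid x‖ + ‖x 1 - centroid x‖ :=
    norm_sub_centroid_le_add x 2
  have p0 := norm_nonneg (x 0 - centroid x)
  have p1 := norm_nonneg (x 1 - centroid x)
  have p2 := norm_nonneg (x 2 - centroid x)
  unfold centralSpread centralEnergy
  generalize ‖x 0 - centroid x‖ = a at *
  generalize ‖x 1 - centroid x‖ = b at *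
  generalize ‖x 2 - centroid x‖ = c at *
  have key : ∀ {a b c : ℝ}, 0 ≤ a → 0 ≤ b → 0 ≤ c → c ≤ a + b →
      (a - b) ^ 2 * (a ^ 2 + b ^ 2 + c ^ 2) ≤ 2 * (a ^ 2 - b ^ 2) ^ 2 := by
    intro a b c ha hb hc hab
    have : a ^ 2 + b ^ 2 + c ^ 2 ≤ 2 * (a + b) ^ 2 := by nlinarith [mul_nonneg ha hb]
    calc _ ≤ (a - b) ^ 2 * (2 * (a + b) ^ 2) := mul_le_mul_of_nonneg_left this (sq_nonneg _)
      _ = _ := by ring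
  have k0 := key p0 p1 p2 t2
  have k1 := key p1 p2 p0 t0
  have k2 := key p2 p0 p1 t1
  linarith

theorem deficit_theta_le {x : Fin 3 → EuclideanSpace ℝ (Fin 2)} (h : centralCross x ≠ 0) :
    equilateralDeficit (theta x)
      ≤ (1 - √3 / 6 * (|centralCross x| / centralEnergy x)) * equilateralDeficit x := by
  have hS := centralEnergy_pos h
  have h1 := centralEnergy_theta_le h
  have h2 := mul_le_mul_of_nonneg_left (abs_centralCross_add_le_theta h)
    (by positivity : 0 ≤ 2 * √3)
  have h3 := mul_le_mul_of_nonneg_left (deficit_le_spread h)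
    (by positivity : 0 ≤ √3 / 6 * (|centralCross x| / centralEnergy x))
  have e : equilateralDeficit (theta x)
      = centralEnergy (theta x) - 2 * √3 * |centralCross (theta x)| := rfl
  have e' : equilateralDeficit x = centralEnergy x - 2 * √3 * |centralCross x| := rfl
  have e2 : √3 / 6 * (|centralCross x| / centralEnergy x) * (4 * centralSpread x)
      = 2 * √3 * (|centralCross x| * (centralSpread x / centralEnergy x) / 3) := by
    field_simp; ring
  rw [e2] at h3
  rw [sub_mul, one_mul]
  linarith

theorem norm_theta_sub_le {x : Fin 3 → EuclideanSpace ℝ (Fin 2)} (h : centralCross x ≠ 0)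
    (i : Fin 3) : ‖theta x i - x i‖ ≤ 4 / 3 * √(centralSpread x) := by
  have hb (j : Fin 3) : ‖(tratio x j - 1) • (x j - centroid x)‖ ≤ √(centralSpread x) := by
    have e : ‖(tratio x j - 1) • (x j - centroid x)‖
        = |‖x (j - 1) - centroid x‖ - ‖x j - centroid x‖| := by
      rw [← tratio_mul_norm h j, ← sub_one_mul, abs_mul, abs_norm, norm_smul, Real.norm_eq_abs]
    rw [e]
    apply Real.abs_le_sqrt
    unfold centralSpread
    fin_cases j
    · change (‖x 2 - centroid x‖ - ‖x 0 - centroid x‖) ^ 2 ≤ _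
      nlinarith [sq_nonneg (‖x 0 - centroid x‖ - ‖x 1 - centroid x‖),
        sq_nonneg (‖x 1 - centroid x‖ - ‖x 2 - centroid x‖)]
    · change (‖x 0 - centroid x‖ - ‖x 1 - centroid x‖) ^ 2 ≤ _
      nlinarith [sq_nonneg (‖x 2 - centroid x‖ - ‖x 0 - centroid x‖),
        sq_nonneg (‖x 1 - centroid x‖ - ‖x 2 - centroid x‖)]
    · change (‖x 1 - centroid x‖ - ‖x 2 - centroid x‖) ^ 2 ≤ _
      nlinarith [sq_nonneg (‖x 2 - centroid x‖ - ‖x 0 - centroid x‖),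
        sq_nonneg (‖x 0 - centroid x‖ - ‖x 1 - centroid x‖)]
  have e : theta x i - x i = (2 / 3 : ℝ) • ((tratio x i - 1) • (x i - centroid x))
      - ((1 / 3 : ℝ) • ((tratio x (i + 1) - 1) • (x (i + 1) - centroid x))
        + (1 / 3 : ℝ) • ((tratio x (i - 1) - 1) • (x (i - 1) - centroid x))) := by
    fin_cases i <;> ext k <;> simp [theta, centroid, show (0 : Fin 3) - 1 = 2 from rfl,
      show (2 : Fin 3) - 1 = 1 from rfl, show (1 : Fin 3) + 1 = 2 from rfl,
      show (2 : Fin 3) + 1 = 0 from rfl] <;> ring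
  rw [e]
  grw [norm_sub_le, norm_add_le]
  simp only [norm_smul (2 / 3 : ℝ), norm_smul (1 / 3 : ℝ)]
  norm_num
  linarith [hb i, hb (i + 1), hb (i - 1)]

theorem continuous_centralCross : Continuous centralCross := by
  unfold centralCross
  fun_prop

theorem continuous_equilateralDeficit : Continuous equilateralDeficit := by
  unfold equilateralDeficit centralEnergy centralCross centroid
  fun_prop

theorem sides_eq_of_centralSpread_eq_zero {y : Fin 3 → EuclideanSpace ℝ (Fin 2)}
    (h : centralSpread y = 0) :
    ‖y 1 - y 0‖ = ‖y 2 - y 1‖ ∧ ‖y 2 - y 1‖ = ‖y 0 - y 2‖ := by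
  have h01 : ‖y 0 - centroid y‖ = ‖y 1 - centroid y‖ := by
    unfold centralSpread at h
    nlinarith [sq_nonneg (‖y 0 - centroid y‖ - ‖y 1 - centroid y‖),
      sq_nonneg (‖y 1 - centroid y‖ - ‖y 2 - centroid y‖),
      sq_nonneg (‖y 2 - centroid y‖ - ‖y 0 - centroid y‖)]
  have h12 : ‖y 1 - centroid y‖ = ‖y 2 - centroid y‖ := by
    unfold centralSpread at h
    nlinarith [sq_nonneg (‖y 0 - centroid y‖ - ‖y 1 - centroid y‖),
      sq_nonneg (‖y 1 - centroid y‖ - ‖y 2 - centroid y‖),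
      sq_nonneg (‖y 2 - centroid y‖ - ‖y 0 - centroid y‖)]
  have s01 := congrArg (· ^ 2) h01
  have s12 := congrArg (· ^ 2) h12
  simp only [EuclideanSpace.real_norm_sq_eq, Fin.sum_univ_two,
    centroid, PiLp.sub_apply, PiLp.smul_apply, PiLp.add_apply, smul_eq_mul] at s01 s12
  constructor <;> rw [← sq_eq_sq₀ (norm_nonneg _) (norm_nonneg _)] <;>
    simp only [EuclideanSpace.real_norm_sq_eq, Fin.sum_univ_two, PiLp.sub_apply] <;>
    linarith

/-- (Theorem 2.4) If all iterates `θⁿ(Δ)` of a triangle `Δ` are defined (are triangles),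
then the iterates converge at exponential rate to an equilateral triangle. -/
theorem theta_iterates_tendsto_equilateral_exponentially
    (x : Fin 3 → EuclideanSpace ℝ (Fin 2))
    (hx : ∀ n : ℕ, IsTriangle (theta^[n] x)) :
    ∃ y : Fin 3 → EuclideanSpace ℝ (Fin 2), IsTriangle y ∧
      ‖y 1 - y 0‖ = ‖y 2 - y 1‖ ∧ ‖y 2 - y 1‖ = ‖y 0 - y 2‖ ∧
      ∃ C : ℝ, 0 < C ∧ ∃ μ : ℝ, 0 < μ ∧ μ < 1 ∧
        ∀ n : ℕ, ∀ i : Fin 3, ‖theta^[n] x i - y i‖ ≤ C * μ ^ n := by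
  have hx' (n : ℕ) : centralCross (theta^[n] x) ≠ 0 :=
    isTriangle_iff_centralCross_ne_zero.mp (hx n)
  have hsucc (n : ℕ) : theta^[n + 1] x = theta (theta^[n] x) :=
    Function.iterate_succ_apply' theta n x
  have hx0 : centralCross x ≠ 0 := hx' 0
  have hD0 : 0 < |centralCross x| := abs_pos.mpr hx0
  have hS0 := centralEnergy_pos hx0
  have hE0 := deficit_nonneg hx0
  have hD (n : ℕ) : |centralCross x| ≤ |centralCross (theta^[n] x)| := by
    induction n with
    | zero => rfl
    | succ k ih => rw [hsucc]; exact ih.trans (abs_centralCross_le_theta (hx' k))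
  have hS (n : ℕ) : centralEnergy (theta^[n] x) ≤ centralEnergy x := by
    induction n with
    | zero => rfl
    | succ k ih => rw [hsucc]; exact (centralEnergy_theta_le (hx' k)).trans ih
  have h3 : 0 < √(3 : ℝ) := by positivity
  obtain ⟨κ, hκ⟩ : ∃ κ, κ = √3 / 6 * (|centralCross x| / centralEnergy x) := ⟨_, rfl⟩
  have hκ0 : 0 < κ := by rw [hκ]; positivity
  have hκ1 : κ < 1 := by
    have : κ * centralEnergy x < 1 * centralEnergy x := by
      have e : κ * centralEnergy x = √3 / 6 * |centralCross x| := by rw [hκ]; field_simp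
      unfold equilateralDeficit at hE0
      rw [e]
      nlinarith [mul_pos h3 hD0]
    exact lt_of_mul_lt_mul_right this hS0.le
  have hE (n : ℕ) : equilateralDeficit (theta^[n] x) ≤ equilateralDeficit x * (1 - κ) ^ n := by
    induction n with
    | zero => simp
    | succ k ih =>
      have hκk : κ ≤ √3 / 6 * (|centralCross (theta^[k] x)| / centralEnergy (theta^[k] x)) := by
        have := centralEnergy_pos (hx' k)
        rw [hκ]
        exact mul_le_mul_of_nonneg_left
          (div_le_div₀ (abs_nonneg _) (hD k) this (hS k)) (by positivity)
      rw [hsucc]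
      calc _ ≤ _ := deficit_theta_le (hx' k)
        _ ≤ (1 - κ) * equilateralDeficit (theta^[k] x) :=
          mul_le_mul_of_nonneg_right (by linarith) (deficit_nonneg (hx' k))
        _ ≤ (1 - κ) * (equilateralDeficit x * (1 - κ) ^ k) :=
          mul_le_mul_of_nonneg_left ih (by linarith)
        _ = _ := by ring
  have hμ0 : 0 < √(1 - κ) := Real.sqrt_pos.mpr (by linarith)
  have hμ1 : √(1 - κ) < 1 := by
    rw [Real.sqrt_lt' one_pos]; linarith
  obtain ⟨K, hK⟩ : ∃ K, K = 4 / 3 * √(2 * equilateralDeficit x) := ⟨_, rfl⟩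
  have hK0 : 0 ≤ K := by rw [hK]; positivity
  have hstep (i : Fin 3) (n : ℕ) :
      dist (theta^[n] x i) (theta^[n + 1] x i) ≤ K * √(1 - κ) ^ n := by
    rw [dist_comm, dist_eq_norm, hsucc]
    refine (norm_theta_sub_le (hx' n) i).trans ?_
    have e : √((1 - κ) ^ n) = √(1 - κ) ^ n := by
      rw [Real.sqrt_eq_iff_eq_sq (by apply pow_nonneg; linarith) (by positivity), ← pow_mul,
        mul_comm, pow_mul, Real.sq_sqrt (by linarith)]
    rw [hK, mul_assoc, ← e, ← Real.sqrt_mul (by linarith)]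
    gcongr
    linarith [spread_le_deficit (hx' n), hE n]
  have hlim (i : Fin 3) :=
    cauchySeq_tendsto_of_complete (cauchySeq_of_le_geometric _ _ hμ1 (hstep i))
  choose y hy using hlim
  have hy' : Filter.Tendsto (fun n => theta^[n] x) Filter.atTop (nhds y) :=
    tendsto_pi_nhds.mpr hy
  have hDy : |centralCross x| ≤ |centralCross y| :=
    ge_of_tendsto' ((continuous_centralCross.tendsto y).comp hy').abs hD
  have hy0 : centralCross y ≠ 0 := abs_pos.mp (hD0.trans_le hDy)
  have hEy : equilateralDeficit y ≤ 0 := by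
    have hz : Filter.Tendsto (fun n => equilateralDeficit x * (1 - κ) ^ n) Filter.atTop
        (nhds 0) := by
      simpa using (tendsto_pow_atTop_nhds_zero_of_lt_one (by linarith : 0 ≤ 1 - κ)
        (by linarith)).const_mul (equilateralDeficit x)
    exact le_of_tendsto_of_tendsto' ((continuous_equilateralDeficit.tendsto y).comp hy') hz hE
  have hQy : centralSpread y = 0 := by
    apply le_antisymm
    · linarith [spread_le_deficit hy0]
    · unfold centralSpread; positivity
  obtain ⟨hs1, hs2⟩ := sides_eq_of_centralSpread_eq_zero hQy
  refine ⟨y, isTriangle_iff_centralCross_ne_zero.mpr hy0, hs1, hs2,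
    K / (1 - √(1 - κ)) + 1, ?_, √(1 - κ), hμ0, hμ1, fun n i => ?_⟩
  · have : 0 < 1 - √(1 - κ) := by linarith
    positivity
  · have h := dist_le_of_le_geometric_of_tendsto _ _ hμ1 (hstep i) (hy i) n
    rw [← dist_eq_norm, add_mul, ← div_mul_eq_mul_div] at *
    have : 0 ≤ √(1 - κ) ^ n := by positivity
    linarith
end

section
/- The explicit formula solves the initial value problem: the function R(t) = (R₀(t),R₁(t),R₂(t)) defined by Rᵢ(t) = R̄ + (1/3)·e^{−t/2}·(cᵢ·cos(√3·t/2) + sᵢ·sin(√3·t/2)) satisfies Rᵢ(0) = Rᵢ for i = 0,1,2 and, for all t ∈ ℝ and i ∈ ℤ₃, the differential equation Rᵢ'(t) = (1/3)·(2R_{i+2}(t) − R_{i+1}(t) − Rᵢ(t)), i.e. R'(t) = M R(t); moreover Rᵢ'(t) = R_{i+2}(t) − R̄ for all t. -/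
/-- The average `R̄ = (1/3)(R₀+R₁+R₂)` of the initial values. -/
noncomputable def Rbar (R : Fin 3 → ℝ) : ℝ := (1 / 3) * (R 0 + R 1 + R 2)

/-- The coefficient `cᵢ = 2Rᵢ − R_{i+1} − R_{i+2}` (indices mod 3). -/
noncomputable def cCoef (R : Fin 3 → ℝ) (i : Fin 3) : ℝ :=
  2 * R i - R (i + 1) - R (i + 2)

/-- The coefficient `sᵢ = √3·(R_{i+2} − R_{i+1})` (indices mod 3). -/
noncomputable def sCoef (R : Fin 3 → ℝ) (i : Fin 3) : ℝ :=
  Real.sqrt 3 * (R (i + 2) - R (i + 1))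

/-- The explicit solution
`Rᵢ(t) = R̄ + (1/3)·e^{−t/2}·(cᵢ·cos(√3·t/2) + sᵢ·sin(√3·t/2))`. -/
noncomputable def sol (R : Fin 3 → ℝ) (i : Fin 3) (t : ℝ) : ℝ :=
  Rbar R + (1 / 3) * Real.exp (-t / 2) *
    (cCoef R i * Real.cos (Real.sqrt 3 * t / 2) +
     sCoef R i * Real.sin (Real.sqrt 3 * t / 2))

theorem add_two_add_one (i : Fin 3) : i + 2 + 1 = i := by fin_cases i <;> rfl

theorem add_two_add_two (i : Fin 3) : i + 2 + 2 = i + 1 := by fin_cases i <;> rfl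

theorem cCoef_add_two (R : Fin 3 → ℝ) (i : Fin 3) :
    cCoef R (i + 2) = (Real.sqrt 3 * sCoef R i - cCoef R i) / 2 := by
  have h : Real.sqrt 3 * Real.sqrt 3 = 3 := Real.mul_self_sqrt (by norm_num)
  simp only [cCoef, sCoef, add_two_add_one, add_two_add_two]
  linear_combination (-(R (i + 2) - R (i + 1)) / 2) * h

theorem sCoef_add_two (R : Fin 3 → ℝ) (i : Fin 3) :
    sCoef R (i + 2) = -(Real.sqrt 3 * cCoef R i + sCoef R i) / 2 := by
  simp only [cCoef, sCoef, add_two_add_one, add_two_add_two]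
  ring

theorem Rbar_eq (R : Fin 3 → ℝ) (i : Fin 3) :
    Rbar R = (1 / 3) * (R i + R (i + 1) + R (i + 2)) := by
  fin_cases i <;> simp [Rbar] <;> ring

theorem sol_zero (R : Fin 3 → ℝ) (i : Fin 3) : sol R i 0 = R i := by
  simp only [sol, cCoef, Rbar_eq R i, neg_zero, zero_div, mul_zero, Real.exp_zero,
    Real.cos_zero, Real.sin_zero]
  ring

theorem sol_sum (R : Fin 3 → ℝ) (i : Fin 3) (t : ℝ) :
    sol R i t + sol R (i + 1) t + sol R (i + 2) t = 3 * Rbar R := by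
  have h : i + 1 + 1 = i + 2 ∧ i + 1 + 2 = i := by fin_cases i <;> exact ⟨rfl, rfl⟩
  simp only [sol, cCoef, sCoef, add_two_add_one, add_two_add_two, h.1, h.2]
  ring

theorem hasDerivAt_sol (R : Fin 3 → ℝ) (i : Fin 3) (t : ℝ) :
    HasDerivAt (sol R i) (sol R (i + 2) t - Rbar R) t := by
  have hexp : HasDerivAt (fun t : ℝ => Real.exp (-t / 2)) (Real.exp (-t / 2) * (-1 / 2)) t :=
    ((hasDerivAt_id t).neg.div_const 2).exp
  have hlin : HasDerivAt (fun t : ℝ => Real.sqrt 3 * t / 2) (Real.sqrt 3 * 1 / 2) t :=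
    ((hasDerivAt_id t).const_mul _).div_const 2
  have h := ((hexp.const_mul (1 / 3)).mul
    ((hlin.cos.const_mul (cCoef R i)).add (hlin.sin.const_mul (sCoef R i)))).const_add (Rbar R)
  refine h.congr_deriv ?_
  simp only [sol, cCoef_add_two, sCoef_add_two, Pi.add_apply]
  ring

/-- The explicit formula solves the initial value problem: `Rᵢ(0) = Rᵢ`, and for all
`t`, `Rᵢ'(t) = (1/3)(2R_{i+2}(t) − R_{i+1}(t) − Rᵢ(t))` (i.e. `R' = M R`); moreover
`Rᵢ'(t) = R_{i+2}(t) − R̄`. -/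
theorem sol_solves_ivp (R : Fin 3 → ℝ) :
    ∀ i : Fin 3, sol R i 0 = R i ∧
      ∀ t : ℝ,
        HasDerivAt (sol R i)
          ((1 / 3) * (2 * sol R (i + 2) t - sol R (i + 1) t - sol R i t)) t ∧
        HasDerivAt (sol R i) (sol R (i + 2) t - Rbar R) t := by
  refine fun i => ⟨sol_zero R i, fun t => ⟨?_, hasDerivAt_sol R i t⟩⟩
  refine (hasDerivAt_sol R i t).congr_deriv ?_
  linear_combination (1 / 3) * sol_sum R i t
end

section
/- For positive adaptive parameters the sign of the real part of the nonzero eigenvalues is determined by the line α₁ = (1+√3)α₀: for all real α₀, α₁ > 0, the quantity Q(α₀,α₁) = −(1/6)(2α₀α₁ − α₁² + 2α₀²) satisfies Q(α₀,α₁) = 0 if and only if α₁ = (1+√3)α₀, and Q(α₀,α₁) < 0 if and only if α₁ < (1+√3)α₀. -/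
/-- For positive adaptive parameters `α₀, α₁ > 0`, the real part
`Q(α₀,α₁) = −(1/6)(2α₀α₁ − α₁² + 2α₀²)` of the nonzero eigenvalues vanishes iff
`α₁ = (1+√3)α₀` and is strictly negative iff `α₁ < (1+√3)α₀`. -/
theorem adaptive_real_part_sign (α₀ α₁ : ℝ) (h₀ : 0 < α₀) (h₁ : 0 < α₁) :
    (-(1 / 6) * (2 * α₀ * α₁ - α₁ ^ 2 + 2 * α₀ ^ 2) = 0 ↔
        α₁ = (1 + Real.sqrt 3) * α₀) ∧
    (-(1 / 6) * (2 * α₀ * α₁ - α₁ ^ 2 + 2 * α₀ ^ 2) < 0 ↔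
        α₁ < (1 + Real.sqrt 3) * α₀) := by
  have hs : Real.sqrt 3 ^ 2 = 3 := Real.sq_sqrt (by norm_num)
  have hs1 : 1 < Real.sqrt 3 := by
    rw [Real.lt_sqrt zero_le_one]
    norm_num
  have hpos : 0 < (α₁ + (Real.sqrt 3 - 1) * α₀) / 6 := by
    have := mul_pos (sub_pos.2 hs1) h₀
    positivity
  have hfac : -(1 / 6) * (2 * α₀ * α₁ - α₁ ^ 2 + 2 * α₀ ^ 2) =
      (α₁ + (Real.sqrt 3 - 1) * α₀) / 6 * (α₁ - (1 + Real.sqrt 3) * α₀) := by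
    linear_combination (α₀ ^ 2 / 6) * hs
  rw [hfac]
  exact ⟨by rw [mul_eq_zero, or_iff_right hpos.ne', sub_eq_zero],
    by rw [← not_le, mul_nonneg_iff_of_pos_left hpos, not_le, sub_neg]⟩
end
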